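/- (Classification of fourfolds with trivial canonical bundle in OGr(n−1,2n).) Let n ≥ 4 and let β¹, …, β^m be nonzero n-tuples with β₁ ≥ … ≥ β_{n−1} ≥ |β_n|, each with entries all integers or all half-odd-integers, such that: no β^i equals (1,0,…,0); at least one β^i has non-integer entries or has β^i_n ≠ 0; ∑_i rank(β^i) = (n−1)(n+1) − n(n−1)/2 − 4; ∑_i dex(β^i) = n; and ∑_i rank(β^i)·β^i_n = 0. Then, up to reordering and up to simultaneously replacing the last entry β^i_n by −β^i_n for every i, (n, (β¹,…,β^m)) is one of the following seventeen: for n=4: (1) (3/2,1/2,1/2,1/2), (1/2,1/2,1/2,−1/2), (1,1,1,−1); (2) (1,1,1,1) twice, (1,1,1,−1), (1/2,1/2,1/2,−1/2) twice; (3) (1,1,0,0), (1,1,1,−1), (1,1,1,1); (4) (1,1,0,0), (3/2,3/2,3/2,−1/2), (1/2,1/2,1/2,1/2); (5) (1,1,1,0) three times, (1/2,1/2,1/2,−1/2), (1/2,1/2,1/2,1/2); (6) (1,1,1,0), (1,1,1,−1), (1,1,1,1), (1/2,1/2,1/2,−1/2), (1/2,1/2,1/2,1/2); (7) (1,1,1,0)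 twice, (1/2,1/2,1/2,−1/2) twice, (1,1,1,1); (8) (2,2,2,0), (1/2,1/2,1/2,−1/2) twice, (1/2,1/2,1/2,1/2) twice; (9) (2,2,2,1), (1/2,1/2,1/2,−1/2) three times, (1/2,1/2,1/2,1/2); (10) (1/2,1/2,1/2,−1/2) four times, (2,2,2,2); (11) (1,1,1,0), (3/2,3/2,3/2,1/2), (1/2,1/2,1/2,−1/2) twice, (1/2,1/2,1/2,1/2); (12) (1,1,1,1), (1/2,1/2,1/2,−1/2) three times, (3/2,3/2,3/2,1/2); (13) (3/2,3/2,3/2,−1/2), (1,1,1,1), (1/2,1/2,1/2,−1/2) twice, (1/2,1/2,1/2,1/2); (14) (1,1,1,0), (1/2,1/2,1/2,−1/2) three times, (3/2,3/2,3/2,3/2); (15) (1,1,1,−1), (3/2,3/2,3/2,3/2), (1/2,1/2,1/2,−1/2) twice, (1/2,1/2,1/2,1/2); and for n=5: (16) (1/2,1/2,1/2,1/2,−1/2) five times, (1/2,1/2,1/2,1/2,1/2) five times; (17) (1,1,0,0,0), (1/2,1/2,1/2,1/2,−1/2) twice, (1/2,1/2,1/2,1/2,1/2) twice. -/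

import Mathlib

open Finset

/-- Weyl dimension formula `D_r` for `sl(r)`, applied to the entries
`β 0, …, β (r-1)` (0-indexed versions of `β₁, …, β_r`). -/
def slDim (r : ℕ) (β : ℕ → ℚ) : ℚ :=
  ∏ i ∈ Finset.range r, ∏ j ∈ Finset.range r,
    if i < j then ((j : ℚ) - (i : ℚ) + β i - β j) / ((j : ℚ) - (i : ℚ)) else 1

/-- Weyl dimension formula `C_m` for `sp(2m)`. -/
def spDim (m : ℕ) (β : ℕ → ℚ) : ℚ :=
  slDim m β *
    ∏ i ∈ Finset.range m, ∏ j ∈ Finset.range m,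
      if i ≤ j then
        ((2 * m : ℚ) - (i : ℚ) - (j : ℚ) + β i + β j) /
          ((2 * m : ℚ) - (i : ℚ) - (j : ℚ))
      else 1

/-- Weyl dimension formula `B_m` for `so(2m+1)`. -/
def soOddDim (m : ℕ) (β : ℕ → ℚ) : ℚ :=
  slDim m β *
    ∏ i ∈ Finset.range m, ∏ j ∈ Finset.range m,
      if i ≤ j then
        ((2 * m : ℚ) - 1 - (i : ℚ) - (j : ℚ) + β i + β j) /
          ((2 * m : ℚ) - 1 - (i : ℚ) - (j : ℚ))
      else 1

/-- Weyl dimension formula `E_m` for `so(2m)`. -/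
def soEvenDim (m : ℕ) (β : ℕ → ℚ) : ℚ :=
  slDim m β *
    ∏ i ∈ Finset.range m, ∏ j ∈ Finset.range m,
      if i < j then
        ((2 * m : ℚ) - 2 - (i : ℚ) - (j : ℚ) + β i + β j) /
          ((2 * m : ℚ) - 2 - (i : ℚ) - (j : ℚ))
      else 1

/-- The tuple determined by a list, extended by zeros. -/
def lw (l : List ℚ) : ℕ → ℚ := fun i => l.getD i 0

/-- `β₁ + ⋯ + β_k` (the sum of the first `k` entries). -/
def headSum (k : ℕ) (β : ℕ → ℚ) : ℚ := ∑ i ∈ Finset.range k, β i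

/-- A weight for the ordinary Grassmannian `Gr(k,n)`: integers
`β₁ ≥ β₂ ≥ ⋯ ≥ β_n = 0`, extended by zeros beyond position `n`. -/
def IsGrWeight (n : ℕ) (β : ℕ → ℚ) : Prop :=
  (∀ i, ∃ z : ℤ, β i = (z : ℚ)) ∧ (∀ i j, i ≤ j → β j ≤ β i) ∧ ∀ i, n - 1 ≤ i → β i = 0

/-- `rank(β) = D_k(β₁,…,β_k) ⬝ D_{n-k}(β_{k+1},…,β_n)` on `Gr(k,n)`. -/
def grRank (k n : ℕ) (β : ℕ → ℚ) : ℚ := slDim k β * slDim (n - k) (fun i => β (k + i))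

/-- `dex(β) = (|β|₁/k − |β|₂/(n−k)) ⬝ rank(β)` on `Gr(k,n)`. -/
def grDex (k n : ℕ) (β : ℕ → ℚ) : ℚ :=
  (headSum k β / (k : ℚ) -
      (∑ i ∈ Finset.range (n - k), β (k + i)) / ((n : ℚ) - (k : ℚ))) * grRank k n β

/-- A weight for the symplectic Grassmannian `IGr(k,2n)`: integers
`β₁ ≥ ⋯ ≥ β_n ≥ 0`, extended by zeros beyond position `n`. -/
def IsIGrWeight (n : ℕ) (β : ℕ → ℚ) : Prop :=
  (∀ i, ∃ z : ℤ, β i = (z : ℚ)) ∧ (∀ i j, i ≤ j → β j ≤ β i) ∧ ∀ i, n ≤ i → β i = 0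

/-- `rank(β) = D_k(β₁,…,β_k) ⬝ C_{n-k}(β_{k+1},…,β_n)` on `IGr(k,2n)`. -/
def igrRank (k n : ℕ) (β : ℕ → ℚ) : ℚ := slDim k β * spDim (n - k) (fun i => β (k + i))

/-- `dex(β) = ((β₁+⋯+β_k)/k) ⬝ rank(β)` on `IGr(k,2n)`. -/
def igrDex (k n : ℕ) (β : ℕ → ℚ) : ℚ := headSum k β / (k : ℚ) * igrRank k n β

/-- A weight for the odd orthogonal Grassmannian `OGr(k,2n+1)`:
`β₁ ≥ ⋯ ≥ β_n ≥ 0`, all entries integers or all half-odd-integers,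
extended by zeros beyond position `n`. -/
def IsOGrOddWeight (n : ℕ) (β : ℕ → ℚ) : Prop :=
  ((∀ i, i < n → ∃ z : ℤ, β i = (z : ℚ)) ∨
    (∀ i, i < n → ∃ z : ℤ, β i = (z : ℚ) + 1/2)) ∧
  (∀ i j, i ≤ j → j < n → β j ≤ β i) ∧ (∀ i, i < n → 0 ≤ β i) ∧ ∀ i, n ≤ i → β i = 0

/-- `rank(β) = D_k(β₁,…,β_k) ⬝ B_{n-k}(β_{k+1},…,β_n)` on `OGr(k,2n+1)`. -/
def ogrOddRank (k n : ℕ) (β : ℕ → ℚ) : ℚ :=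
  slDim k β * soOddDim (n - k) (fun i => β (k + i))

/-- `dex(β) = ((β₁+⋯+β_k)/k) ⬝ rank(β)` on `OGr(k,2n+1)`. -/
def ogrOddDex (k n : ℕ) (β : ℕ → ℚ) : ℚ := headSum k β / (k : ℚ) * ogrOddRank k n β

/-- A weight for the even orthogonal Grassmannian `OGr(k,2n)`:
`β₁ ≥ ⋯ ≥ β_{n-1} ≥ |β_n|`, all entries integers or all half-odd-integers,
extended by zeros beyond position `n`. -/
def IsOGrEvenWeight (n : ℕ) (β : ℕ → ℚ) : Prop :=
  ((∀ i, i < n → ∃ z : ℤ, β i = (z : ℚ)) ∨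
    (∀ i, i < n → ∃ z : ℤ, β i = (z : ℚ) + 1/2)) ∧
  (∀ i j, i ≤ j → j + 1 < n → β j ≤ β i) ∧
  (∀ i, i + 1 < n → |β (n - 1)| ≤ β i) ∧ ∀ i, n ≤ i → β i = 0

/-- `rank(β) = D_k(β₁,…,β_k) ⬝ E_{n-k}(β_{k+1},…,β_n)` on `OGr(k,2n)`. -/
def ogrEvenRank (k n : ℕ) (β : ℕ → ℚ) : ℚ :=
  slDim k β * soEvenDim (n - k) (fun i => β (k + i))

/-- `dex(β) = ((β₁+⋯+β_k)/k) ⬝ rank(β)` on `OGr(k,2n)`. -/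
def ogrEvenDex (k n : ℕ) (β : ℕ → ℚ) : ℚ := headSum k β / (k : ℚ) * ogrEvenRank k n β

/-- Replace the last entry `β_n` by its negative. -/
def negLast (n : ℕ) (β : ℕ → ℚ) : ℕ → ℚ := fun i => if i = n - 1 then -β i else β i

/-- The weight of the spin line bundle `L₊` on `OGr(n-1,2n)` (length-`n` tuple). -/
def halfP (n : ℕ) : ℕ → ℚ := lw (List.replicate n (1/2))

/-- The weight of the spin line bundle `L₋` on `OGr(n-1,2n)` (length-`n` tuple
with last entry `-1/2`). -/
def halfM (n : ℕ) : ℕ → ℚ := lw (List.replicate (n - 1) (1/2) ++ [-(1/2)])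

section Enumeration

variable {α : Type*} [DecidableEq α]

/-- All multisets supported on a given list with prescribed totals of the three
weights `rk`, `ex` (natural numbers) and `dt` (an integer). -/
def multisetsWithTotals (rk ex : α → ℕ) (dt : α → ℤ) :
    List α → ℕ → ℕ → ℤ → List (Multiset α)
  | [], r, e, d => if r = 0 ∧ e = 0 ∧ d = 0 then [0] else []
  | x :: L, r, e, d => (List.range (r + 1)).flatMap fun k =>
      if k * rk x ≤ r ∧ k * ex x ≤ e then
        (multisetsWithTotals rk ex dt L (r - k * rk x) (e - k * ex x) (d - k * dt x)).map
          (Multiset.replicate k x + ·)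
      else []

theorem mem_multisetsWithTotals (rk ex : α → ℕ) (dt : α → ℤ) (hpos : ∀ x, 0 < rk x)
    (L : List α) (T : Multiset α) (hT : ∀ x ∈ T, x ∈ L) :
    T ∈ multisetsWithTotals rk ex dt L (T.map rk).sum (T.map ex).sum (T.map dt).sum := by
  induction L generalizing T with
  | nil =>
    obtain rfl : T = 0 := Multiset.eq_zero_of_forall_notMem fun x hx => by simpa using hT x hx
    simp [multisetsWithTotals]
  | cons x L ih =>
    have hsplit : Multiset.replicate (T.count x) x + T.filter (fun y => ¬ y = x) = T := by
      rw [← Multiset.filter_eq', Multiset.filter_add_not]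
    set k := T.count x
    set U := T.filter (fun y => ¬ y = x)
    have hU : U ∈ multisetsWithTotals rk ex dt L _ _ _ := ih U fun y hy => by
      have hy' := Multiset.mem_filter.1 hy
      exact (List.mem_cons.1 (hT y hy'.1)).resolve_left hy'.2
    have hr : (T.map rk).sum = k * rk x + (U.map rk).sum := by
      rw [← hsplit]; simp
    have he : (T.map ex).sum = k * ex x + (U.map ex).sum := by
      rw [← hsplit]; simp
    have hd : (T.map dt).sum = k * dt x + (U.map dt).sum := by
      rw [← hsplit]; simp
    rw [multisetsWithTotals, List.mem_flatMap]
    refine ⟨k, ?_, ?_⟩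
    · have := Nat.le_mul_of_pos_right k (hpos x)
      rw [List.mem_range]
      omega
    · rw [if_pos (by omega), List.mem_map]
      refine ⟨U, ?_, hsplit⟩
      convert hU using 2 <;> omega

end Enumeration

/-- Pull a multiset of weights with prescribed totals back along a finite parametrization. -/
theorem exists_mem_multisetsWithTotals {k n R E : ℕ} (f : Fin k → ℕ → ℚ) (rk ex : Fin k → ℕ)
    (dt : Fin k → ℤ) (L : List (Fin k)) (hL : ∀ i, i ∈ L) (hpos : ∀ i, 0 < rk i)
    (hrk : ∀ i, slDim (n - 1) (f i) = rk i)
    (hex : ∀ i, 2 * (headSum (n - 1) (f i) / ((n : ℚ) - 1) * slDim (n - 1) (f i)) =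
      rk i + ex i)
    (hdt : ∀ i, 2 * (slDim (n - 1) (f i) * f i (n - 1)) = dt i)
    (S : Multiset (ℕ → ℚ)) (hS : ∀ β ∈ S, ∃ i, f i = β)
    (hr : (S.map (fun β => slDim (n - 1) β)).sum = R)
    (hd : 2 * (S.map (fun β => headSum (n - 1) β / ((n : ℚ) - 1) * slDim (n - 1) β)).sum
      = R + E)
    (hdet : (S.map (fun β => slDim (n - 1) β * β (n - 1))).sum = 0) :
    ∃ T ∈ multisetsWithTotals rk ex dt L R E 0, T.map f = S := by
  have : CanLift (ℕ → ℚ) (Fin k) f (fun β => ∃ i, f i = β) := ⟨fun _ h => h⟩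
  lift S to Multiset (Fin k) using hS with T
  refine ⟨T, ?_, rfl⟩
  rw [← Multiset.sum_map_mul_left] at hd
  have hdet' := congrArg (2 * ·) hdet
  simp only [← Multiset.sum_map_mul_left, mul_zero] at hdet'
  simp only [Multiset.map_map, Function.comp_def, hrk] at hr
  simp only [Multiset.map_map, Function.comp_def, hex, Multiset.sum_map_add] at hd
  simp only [Multiset.map_map, Function.comp_def, hdt] at hdet'
  have hR : (T.map rk).sum = R := by
    have : (((T.map rk).sum : ℕ) : ℚ) = R := by
      rw [Nat.cast_multiset_sum, Multiset.map_map]; exact hr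
    exact_mod_cast this
  have hE : (T.map ex).sum = E := by
    have : (((T.map ex).sum : ℕ) : ℚ) = E := by
      rw [Nat.cast_multiset_sum, Multiset.map_map]
      simp only [Function.comp_def]
      linarith
    exact_mod_cast this
  have hD : (T.map dt).sum = 0 := by
    have : (((T.map dt).sum : ℤ) : ℚ) = 0 := by
      rw [Int.cast_multiset_sum, Multiset.map_map]; exact hdet'
    exact_mod_cast this
  simpa only [hR, hE, hD] using
    mem_multisetsWithTotals rk ex dt hpos L T fun i _ => hL i

theorem one_le_slDim (r : ℕ) (β : ℕ → ℚ) (h : ∀ i j, i ≤ j → j < r → β j ≤ β i) :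
    1 ≤ slDim r β := by
  unfold slDim
  refine Finset.one_le_prod fun i _ => Finset.one_le_prod fun j hj => ?_
  split_ifs with hij
  · have h1 := h i j hij.le (Finset.mem_range.1 hj)
    have h2 : (i : ℚ) < j := by exact_mod_cast hij
    rw [one_le_div (by linarith)]
    linarith
  · exact le_rfl

theorem slDim_three (β : ℕ → ℚ) :
    slDim 3 β = (1 + β 0 - β 1) * ((2 + β 0 - β 2) / 2) * (1 + β 1 - β 2) := by
  norm_num [slDim, Finset.prod_range_succ]

theorem headSum_three (β : ℕ → ℚ) : headSum 3 β = β 0 + β 1 + β 2 := by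
  simp [headSum, Finset.sum_range_succ]

theorem headSum_four (β : ℕ → ℚ) : headSum 4 β = β 0 + β 1 + β 2 + β 3 := by
  simp [headSum, Finset.sum_range_succ]

namespace IsOGrEvenWeight

variable {n : ℕ} {β : ℕ → ℚ}

theorem one_le_slDim (hβ : IsOGrEvenWeight n β) : 1 ≤ slDim (n - 1) β :=
  _root_.one_le_slDim _ _ fun i j hij hj => hβ.2.1 i j hij (by omega)

theorem nonneg (hβ : IsOGrEvenWeight n β) {i : ℕ} (hi : i + 1 < n) : 0 ≤ β i :=
  (abs_nonneg _).trans (hβ.2.2.1 i hi)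

/-- Twice the entries of a weight are integers of the same parity. -/
theorem exists_int (hβ : IsOGrEvenWeight n β) :
    ∃ u : ℕ → ℤ, (∀ i < n, β i = (u i : ℚ) / 2) ∧
      (∀ i j, i < n → j < n → u i % 2 = u j % 2) ∧
      (∀ i j, i ≤ j → j + 1 < n → u j ≤ u i) ∧
      ∀ i, i + 1 < n → |u (n - 1)| ≤ u i := by
  obtain ⟨u, hu, hpar⟩ : ∃ u : ℕ → ℤ, (∀ i < n, β i = (u i : ℚ) / 2) ∧
      ∀ i j, i < n → j < n → u i % 2 = u j % 2 := by
    rcases hβ.1 with h | h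
    · choose! z hz using h
      refine ⟨fun i => 2 * z i, fun i hi => ?_, fun i j _ _ => by simp only; omega⟩
      rw [hz i hi]; push_cast; ring
    · choose! z hz using h
      refine ⟨fun i => 2 * z i + 1, fun i hi => ?_, fun i j _ _ => by simp only; omega⟩
      rw [hz i hi]; push_cast; ring
  refine ⟨u, hu, hpar, fun i j hij hj => ?_, fun i hi => ?_⟩
  · have h := hβ.2.1 i j hij hj
    rw [hu i (by omega), hu j (by omega)] at h
    have : (u j : ℚ) ≤ u i := by linarith
    exact_mod_cast this
  · have h := hβ.2.2.1 i hi
    rw [hu i (by omega), hu (n - 1) (by omega), abs_div, abs_two] at h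
    have : |(u (n - 1) : ℚ)| ≤ u i := by linarith
    exact_mod_cast this

theorem half_le_headSum {m : ℕ} (hm : m ≤ 4) (hmn : m + 1 ≤ n) (hn : 3 ≤ n)
    (hβ : IsOGrEvenWeight n β) (h0 : β ≠ 0) (h1 : β ≠ lw [1]) :
    (m : ℚ) / 2 ≤ headSum (n - 1) β := by
  obtain ⟨u, hu, hpar, hanti, hlast⟩ := hβ.exists_int
  have hnn : ∀ i ∈ Finset.range (n - 1), 0 ≤ β i := fun i hi =>
    hβ.nonneg (by have := Finset.mem_range.1 hi; omega)
  have h01 := hanti 0 1 (by omega) (by omega)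
  have hl1 := abs_le.1 (hlast 1 (by omega))
  by_cases hodd : u (n - 1) % 2 = 1
  · have : ∀ i ∈ Finset.range m, (1 / 2 : ℚ) ≤ β i := fun i hi => by
      have hi := Finset.mem_range.1 hi
      have := hpar i (n - 1) (by omega) (by omega)
      have := abs_le.1 (hlast i (by omega))
      have h : (1 : ℚ) ≤ u i := by exact_mod_cast (by omega : 1 ≤ u i)
      rw [hu i (by omega)]
      linarith
    calc (m : ℚ) / 2 = ∑ _i ∈ Finset.range m, (1 / 2 : ℚ) := by simp [div_eq_mul_inv]
      _ ≤ ∑ i ∈ Finset.range m, β i := Finset.sum_le_sum this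
      _ ≤ headSum (n - 1) β := Finset.sum_le_sum_of_subset_of_nonneg
          (Finset.range_mono (by omega)) fun i hi _ => hnn i hi
  have hp0 := hpar 0 (n - 1) (by omega) (by omega)
  have hp1 := hpar 1 (n - 1) (by omega) (by omega)
  suffices h : 4 ≤ u 0 + u 1 by
    have h' : (4 : ℚ) ≤ u 0 + u 1 := by exact_mod_cast h
    have hm' : (m : ℚ) ≤ 4 := by exact_mod_cast hm
    calc (m : ℚ) / 2 ≤ ∑ i ∈ Finset.range 2, β i := by
          rw [Finset.sum_range_succ, Finset.sum_range_one, hu 0 (by omega), hu 1 (by omega)]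
          linarith
      _ ≤ headSum (n - 1) β := Finset.sum_le_sum_of_subset_of_nonneg
          (Finset.range_mono (by omega)) fun i hi _ => hnn i hi
  by_contra hlt
  have hz : ∀ i, 1 ≤ i → β i = 0 := fun i hi => by
    by_cases hin : n ≤ i
    · exact hβ.2.2.2 i hin
    rw [hu i (by omega)]
    suffices u i = 0 by simp [this]
    by_cases hil : i + 1 < n
    · have := hanti 1 i hi hil
      have := abs_le.1 (hlast i hil)
      omega
    · obtain rfl : i = n - 1 := by omega
      omega
  have hu0 : u 0 = 0 ∨ u 0 = 2 := by omega
  rcases hu0 with h | h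
  · refine h0 (funext fun i => ?_)
    rcases i with _ | i
    · simp [hu 0 (by omega), h]
    · exact hz _ (by omega)
  · refine h1 (funext fun i => ?_)
    rcases i with _ | i
    · simp [hu 0 (by omega), h, lw]
    · simp [hz (i + 1) (by omega), lw]

theorem two_le_headSum (hn : 5 ≤ n) (hβ : IsOGrEvenWeight n β) (h0 : β ≠ 0)
    (h1 : β ≠ lw [1]) : 2 ≤ headSum (n - 1) β := by
  have := hβ.half_le_headSum le_rfl hn (by omega) h0 h1
  norm_num at this
  exact this

theorem eq_of_headSum_eq_two (hβ : IsOGrEvenWeight 5 β) (h : headSum 4 β = 2) :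
    β = lw [2] ∨ β = lw [1, 1] ∨ β = halfM 5 ∨ β = halfP 5 := by
  obtain ⟨u, hu, hpar, hanti, hlast⟩ := hβ.exists_int
  have h01 := hanti 0 1 (by omega) (by omega)
  have h12 := hanti 1 2 (by omega) (by omega)
  have h23 := hanti 2 3 (by omega) (by omega)
  have h34 := abs_le.1 (hlast 3 (by omega))
  have p0 := hpar 0 4 (by omega) (by omega)
  have p1 := hpar 1 4 (by omega) (by omega)
  have p2 := hpar 2 4 (by omega) (by omega)
  have p3 := hpar 3 4 (by omega) (by omega)
  rw [headSum_four, hu 0 (by omega), hu 1 (by omega), hu 2 (by omega), hu 3 (by omega)] at h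
  have hsum : u 0 + u 1 + u 2 + u 3 = 4 := by
    have : (u 0 + u 1 + u 2 + u 3 : ℚ) = 4 := by linarith
    exact_mod_cast this
  norm_num at h34
  have key : (u 0 = 4 ∧ u 1 = 0 ∧ u 2 = 0 ∧ u 3 = 0 ∧ u 4 = 0) ∨
      (u 0 = 2 ∧ u 1 = 2 ∧ u 2 = 0 ∧ u 3 = 0 ∧ u 4 = 0) ∨
      (u 0 = 1 ∧ u 1 = 1 ∧ u 2 = 1 ∧ u 3 = 1 ∧ u 4 = -1) ∨
      (u 0 = 1 ∧ u 1 = 1 ∧ u 2 = 1 ∧ u 3 = 1 ∧ u 4 = 1) := by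
    have hu3 : u 3 = 0 ∨ u 3 = 1 := by omega
    have hu2 : u 2 = u 3 := by omega
    rcases hu3 with h3 | h3 <;> omega
  refine key.imp ?_ (Or.imp ?_ (Or.imp ?_ ?_)) <;> rintro ⟨e0, e1, e2, e3, e4⟩ <;> funext i <;>
    rcases i with _ | _ | _ | _ | _ | i <;>
    simp [lw, halfM, halfP, hu, hβ.2.2.2, e0, e1, e2, e3, e4, List.replicate] <;> norm_num

end IsOGrEvenWeight

/-- The weights of rank at most `5` and small slope on `OGr(3,8)`. -/
def smallWeights : Fin 17 → ℕ → ℚ :=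
  ![lw [2, 2, 2, 2], lw [2, 2, 2, 1], lw [2, 2, 2], lw [2, 2, 2, -1], lw [2, 2, 2, -2],
    lw [3/2, 1/2, 1/2, 1/2], lw [3/2, 1/2, 1/2, -(1/2)],
    lw [3/2, 3/2, 3/2, 3/2], lw [3/2, 3/2, 3/2, 1/2], lw [3/2, 3/2, 3/2, -(1/2)],
    lw [3/2, 3/2, 3/2, -(3/2)],
    lw [1, 1], lw [1, 1, 1, 1], lw [1, 1, 1], lw [1, 1, 1, -1], halfP 4, halfM 4]

/-- The involution of the indices of `smallWeights` induced by `negLast 4`. -/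
def smallWeightsNeg : Fin 17 → Fin 17 :=
  ![4, 3, 2, 1, 0, 6, 5, 10, 9, 8, 7, 11, 14, 13, 12, 16, 15]

theorem negLast_smallWeights (i : Fin 17) :
    negLast 4 (smallWeights i) = smallWeights (smallWeightsNeg i) := by
  funext j
  fin_cases i <;> rcases j with _ | _ | _ | _ | j <;>
    simp [negLast, smallWeights, smallWeightsNeg, lw, halfP, halfM, List.replicate]

/-- Twice the entries of `smallWeights`. -/
def smallInts : Fin 17 → ℤ × ℤ × ℤ × ℤ :=
  ![(4, 4, 4, 4), (4, 4, 4, 2), (4, 4, 4, 0), (4, 4, 4, -2), (4, 4, 4, -4),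
    (3, 1, 1, 1), (3, 1, 1, -1), (3, 3, 3, 3), (3, 3, 3, 1), (3, 3, 3, -1), (3, 3, 3, -3),
    (2, 2, 0, 0), (2, 2, 2, 2), (2, 2, 2, 0), (2, 2, 2, -2), (1, 1, 1, 1), (1, 1, 1, -1)]

set_option maxHeartbeats 1000000 in
theorem smallWeights_eq (i : Fin 17) :
    smallWeights i = lw [((smallInts i).1 : ℚ) / 2, ((smallInts i).2.1 : ℚ) / 2,
      ((smallInts i).2.2.1 : ℚ) / 2, ((smallInts i).2.2.2 : ℚ) / 2] := by
  funext j
  fin_cases i <;> rcases j with _ | _ | _ | _ | j <;>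
    norm_num [smallWeights, smallInts, lw, halfP, halfM, List.replicate]

theorem IsOGrEvenWeight.exists_smallWeights {β : ℕ → ℚ} (hβ : IsOGrEvenWeight 4 β)
    (h0 : β ≠ 0) (h1 : β ≠ lw [1]) (hr : slDim 3 β ≤ 5) (hs : (headSum 3 β / 3 - 1 / 2) * slDim 3 β ≤ 3 / 2) :
    ∃ i, smallWeights i = β := by
  obtain ⟨u, hu, hpar, hanti, hlast⟩ := hβ.exists_int
  have h01 := hanti 0 1 (by omega) (by omega)
  have h12 := hanti 1 2 (by omega) (by omega)
  have h23 := abs_le.1 (hlast 2 (by omega))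
  have p0 := hpar 0 3 (by omega) (by omega)
  have p1 := hpar 1 3 (by omega) (by omega)
  have p2 := hpar 2 3 (by omega) (by omega)
  have hβu : β = lw [(u 0 : ℚ) / 2, (u 1 : ℚ) / 2, (u 2 : ℚ) / 2, (u 3 : ℚ) / 2] := by
    funext j
    rcases j with _ | _ | _ | _ | j <;> simp [lw, hu, hβ.2.2.2]
  have hne0 : ¬ (u 0 = 0 ∧ u 1 = 0 ∧ u 2 = 0 ∧ u 3 = 0) := by
    rintro ⟨e0, e1, e2, e3⟩
    refine h0 (hβu.trans (funext fun j => ?_))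
    rcases j with _ | _ | _ | _ | j <;> simp [lw, e0, e1, e2, e3]
  have hne1 : ¬ (u 0 = 2 ∧ u 1 = 0 ∧ u 2 = 0 ∧ u 3 = 0) := by
    rintro ⟨e0, e1, e2, e3⟩
    refine h1 (hβu.trans (funext fun j => ?_))
    rcases j with _ | _ | _ | _ | j <;> simp [lw, e0, e1, e2, e3]
  suffices ∃ i, smallInts i = (u 0, u 1, u 2, u 3) by
    obtain ⟨i, hi⟩ := this
    exact ⟨i, by rw [smallWeights_eq, hi, hβu]⟩
  obtain ⟨P, hP⟩ : ∃ P, u 0 = u 1 + 2 * P := ⟨(u 0 - u 1) / 2, by omega⟩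
  obtain ⟨Q, hQ⟩ : ∃ Q, u 1 = u 2 + 2 * Q := ⟨(u 1 - u 2) / 2, by omega⟩
  have hP0 : 0 ≤ P := by omega
  have hQ0 : 0 ≤ Q := by omega
  have hdim : slDim 3 β = (1 + P) * (2 + P + Q) * (1 + Q) / 2 := by
    rw [slDim_three, hu 0 (by omega), hu 1 (by omega), hu 2 (by omega), hP, hQ]
    push_cast
    ring
  have hhead : headSum 3 β = (3 * u 2 + 4 * Q + 2 * P) / 2 := by
    rw [headSum_three, hu 0 (by omega), hu 1 (by omega), hu 2 (by omega), hP, hQ]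
    push_cast
    ring
  rw [hdim] at hr
  rw [hdim, hhead] at hs
  have hr' : (1 + P) * (2 + P + Q) * (1 + Q) ≤ 10 := by
    have : ((1 + P) * (2 + P + Q) * (1 + Q) : ℚ) ≤ 10 := by linarith
    exact_mod_cast this
  have hP1 : P ≤ 1 := by
    by_contra! h
    nlinarith [mul_nonneg hP0 hQ0, mul_nonneg (mul_nonneg hP0 hP0) hQ0,
      mul_nonneg (mul_nonneg hP0 hQ0) hQ0]
  have hQ1 : Q ≤ 1 := by
    by_contra! h
    nlinarith [mul_nonneg hP0 hQ0, mul_nonneg (mul_nonneg hP0 hP0) hQ0,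
      mul_nonneg (mul_nonneg hP0 hQ0) hQ0]
  have hPQ : (P = 0 ∧ Q = 0) ∨ (P = 1 ∧ Q = 0) ∨ (P = 0 ∧ Q = 1) := by
    rcases (by omega : P = 0 ∨ P = 1) with rfl | rfl <;>
      rcases (by omega : Q = 0 ∨ Q = 1) with rfl | rfl <;> simp_all
  norm_num at h23
  generalize u 0 = u0, u 1 = u1, u 2 = u2, u 3 = u3 at *
  rcases hPQ with ⟨rfl, rfl⟩ | ⟨rfl, rfl⟩ | ⟨rfl, rfl⟩
  · have hc : u2 ≤ 4 := by
      have : (u2 : ℚ) ≤ 4 := by push_cast at hs; linarith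
      exact_mod_cast this
    obtain rfl : u1 = u2 := by omega
    obtain rfl : u0 = u1 := by omega
    have hpos : 0 < u0 := by omega
    interval_cases u0 <;> obtain ⟨ha, hb⟩ := h23 <;> interval_cases u3 <;>
      first | omega | decide
  · have hc : u2 ≤ 1 := by
      have : (3 * u2 : ℚ) ≤ 4 := by push_cast at hs; linarith
      have : 3 * u2 ≤ 4 := by exact_mod_cast this
      omega
    obtain rfl : u2 = 1 := by omega
    obtain rfl : u1 = 1 := by omega
    obtain rfl : u0 = 3 := by omega
    obtain rfl | rfl : u3 = 1 ∨ u3 = -1 := by omega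
    · exact ⟨5, rfl⟩
    · exact ⟨6, rfl⟩
  · have hc : u2 ≤ 0 := by
      have : (3 * u2 : ℚ) ≤ 2 := by push_cast at hs; linarith
      have : 3 * u2 ≤ 2 := by exact_mod_cast this
      omega
    obtain rfl : u2 = 0 := by omega
    obtain rfl : u3 = 0 := by omega
    obtain rfl : u1 = 2 := by omega
    obtain rfl : u0 = 2 := by omega
    exact ⟨11, rfl⟩

/-- Multisets of indices of `smallWeights` giving the classification on `OGr(3,8)`. -/
def smallSolutions : List (Multiset (Fin 17)) :=
  [{5, 16, 14}, {12, 12, 14, 16, 16}, {11, 14, 12}, {11, 9, 15}, {13, 13, 13, 16, 15},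
    {13, 14, 12, 16, 15}, {13, 13, 16, 16, 12}, {2, 16, 16, 15, 15}, {1, 16, 16, 16, 15},
    {16, 16, 16, 16, 0}, {13, 8, 16, 16, 15}, {12, 16, 16, 16, 8}, {9, 12, 16, 16, 15},
    {13, 16, 16, 16, 7}, {14, 7, 16, 16, 15}]

/-- The ranks of `smallWeights`. -/
def smallRank : Fin 17 → ℕ := ![1, 1, 1, 1, 1, 3, 3, 1, 1, 1, 1, 3, 1, 1, 1, 1, 1]

/-- Twice the dex minus the rank of `smallWeights`. -/
def smallExcess : Fin 17 → ℕ := ![3, 3, 3, 3, 3, 2, 2, 2, 2, 2, 2, 1, 1, 1, 1, 0, 0]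

/-- Twice the contributions of `smallWeights` to the determinant condition. -/
def smallDet : Fin 17 → ℤ := ![4, 2, 0, -2, -4, 3, -3, 3, 1, -1, -3, 0, 2, 0, -2, 1, -1]

theorem multisetsWithTotals_small :
    ∀ T ∈ multisetsWithTotals smallRank smallExcess smallDet
        [0, 1, 2, 3, 4, 5, 6, 7, 8, 9, 10, 11, 12, 13, 14, 15, 16] 5 3 0,
      T = {11, 13, 13} ∨ T ∈ smallSolutions ∨ T.map smallWeightsNeg ∈ smallSolutions := by
  decide +kernel

theorem slDim_smallWeights (i : Fin 17) : slDim 3 (smallWeights i) = smallRank i := by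
  rw [smallWeights_eq, slDim_three]
  fin_cases i <;> norm_num [smallInts, smallRank, lw]

theorem headSum_smallWeights (i : Fin 17) :
    2 * (headSum 3 (smallWeights i) / 3 * slDim 3 (smallWeights i)) =
      smallRank i + smallExcess i := by
  rw [slDim_smallWeights, smallWeights_eq, headSum_three]
  fin_cases i <;> norm_num [smallInts, smallRank, smallExcess, lw]

theorem det_smallWeights (i : Fin 17) :
    2 * (slDim 3 (smallWeights i) * smallWeights i 3) = smallDet i := by
  rw [slDim_smallWeights, smallWeights_eq]
  fin_cases i <;> norm_num [smallInts, smallRank, smallDet, lw]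

/-- The weights of slope `1/2` on `OGr(4,10)`. -/
def halfSlopeWeights : Fin 4 → ℕ → ℚ := ![lw [2], lw [1, 1], halfM 5, halfP 5]

theorem multisetsWithTotals_halfSlope :
    multisetsWithTotals ![10, 6, 1, 1] (fun _ => 0) ![0, 0, -1, 1] [0, 1, 2, 3] 10 0 0 =
      [Multiset.replicate 5 2 + Multiset.replicate 5 3,
        {1} + Multiset.replicate 2 2 + Multiset.replicate 2 3, {0}] := by
  decide +kernel

/-- No fourfold of the type considered exists for `n ≥ 6`, and for `n = 5` all weights have
slope `1/2`. -/
theorem headSum_eq_two_of_five_le {n : ℕ} (hn : 5 ≤ n) (S : Multiset (ℕ → ℚ))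
    (hw : ∀ β ∈ S, IsOGrEvenWeight n β ∧ β ≠ 0 ∧ β ≠ lw [1])
    (hr : (S.map (fun β => slDim (n - 1) β)).sum =
      ((n : ℚ) - 1) * ((n : ℚ) + 1) - (n : ℚ) * ((n : ℚ) - 1) / 2 - 4)
    (hd : (S.map (fun β => headSum (n - 1) β / ((n : ℚ) - 1) * slDim (n - 1) β)).sum
      = (n : ℚ)) :
    n = 5 ∧ ∀ β ∈ S, headSum (n - 1) β = 2 := by
  have hn' : (5 : ℚ) ≤ n := by exact_mod_cast hn
  have hnn : ∀ β ∈ S, 0 ≤ (headSum (n - 1) β - 2) * slDim (n - 1) β := fun β hβ =>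
    mul_nonneg (sub_nonneg.2 ((hw β hβ).1.two_le_headSum hn (hw β hβ).2.1 (hw β hβ).2.2))
      (zero_le_one.trans (hw β hβ).1.one_le_slDim)
  have hsum : (S.map fun β => (headSum (n - 1) β - 2) * slDim (n - 1) β).sum = 10 - 2 * n := by
    have : ∀ β : ℕ → ℚ, (headSum (n - 1) β - 2) * slDim (n - 1) β =
        ((n : ℚ) - 1) * (headSum (n - 1) β / ((n : ℚ) - 1) * slDim (n - 1) β) -
          2 * slDim (n - 1) β := fun β => by
      have : (n : ℚ) - 1 ≠ 0 := by linarith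
      field_simp
    simp only [this]
    rw [Multiset.sum_map_sub, Multiset.sum_map_mul_left, Multiset.sum_map_mul_left, hr, hd]
    ring
  have hnn' : ∀ x ∈ S.map fun β => (headSum (n - 1) β - 2) * slDim (n - 1) β, 0 ≤ x := by
    simpa using hnn
  have hn5 : n = 5 := by
    have := Multiset.sum_nonneg hnn'
    have : (n : ℚ) ≤ 5 := by linarith
    exact le_antisymm (by exact_mod_cast this) hn
  refine ⟨hn5, fun β hβ => ?_⟩
  have hle := Multiset.single_le_sum hnn' _ (Multiset.mem_map_of_mem _ hβ)
  have := (hw β hβ).1.two_le_headSum hn (hw β hβ).2.1 (hw β hβ).2.2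
  have := (hw β hβ).1.one_le_slDim
  rw [hsum] at hle
  nlinarith

theorem exists_smallWeights_of_mem (S : Multiset (ℕ → ℚ))
    (hw : ∀ β ∈ S, IsOGrEvenWeight 4 β ∧ β ≠ 0 ∧ β ≠ lw [1])
    (hr : (S.map (fun β => slDim 3 β)).sum = 5)
    (hd : (S.map (fun β => headSum 3 β / 3 * slDim 3 β)).sum = 4) :
    ∀ β ∈ S, ∃ i, smallWeights i = β := by
  have hpos : ∀ β ∈ S, 0 ≤ slDim 3 β := fun β hβ =>
    zero_le_one.trans (hw β hβ).1.one_le_slDim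
  have hhead : ∀ β ∈ S, 3 / 2 ≤ headSum 3 β := fun β hβ => by
    have := (hw β hβ).1.half_le_headSum (m := 3) (by norm_num) le_rfl (by norm_num)
      (hw β hβ).2.1 (hw β hβ).2.2
    exact_mod_cast this
  have hsum : (S.map fun β => (headSum 3 β / 3 - 1 / 2) * slDim 3 β).sum = 3 / 2 := by
    simp only [sub_mul]
    rw [Multiset.sum_map_sub, Multiset.sum_map_mul_left, hr, hd]
    norm_num
  intro β hβ
  refine (hw β hβ).1.exists_smallWeights (hw β hβ).2.1 (hw β hβ).2.2 ?_ ?_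
  · rw [← hr]
    exact Multiset.single_le_sum (by simpa using hpos) _ (Multiset.mem_map_of_mem _ hβ)
  · rw [← hsum]
    refine Multiset.single_le_sum ?_ _
      (Multiset.mem_map_of_mem (fun β => (headSum 3 β / 3 - 1 / 2) * slDim 3 β) hβ)
    simp only [Multiset.mem_map, forall_exists_index, and_imp, forall_apply_eq_imp_iff₂]
    exact fun γ hγ => mul_nonneg (by linarith [hhead γ hγ]) (hpos γ hγ)

/-- Classification of fourfolds with trivial canonical bundle in `OGr(n−1,2n)`,
where `rank(β) = D_{n−1}(β₁,…,β_{n−1})` and the determinant condition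
`∑ rank(βⁱ)·βⁱ_n = 0` holds. -/
theorem stmt19 (n : ℕ) (hn : 4 ≤ n)
    (S : Multiset (ℕ → ℚ))
    (hw : ∀ β ∈ S, IsOGrEvenWeight n β ∧ β ≠ 0 ∧ β ≠ lw [1])
    (hnew : ∃ β ∈ S, (∃ i, i < n ∧ ∀ z : ℤ, β i ≠ (z : ℚ)) ∨ β (n - 1) ≠ 0)
    (hr : (S.map (fun β => slDim (n - 1) β)).sum =
      ((n : ℚ) - 1) * ((n : ℚ) + 1) - (n : ℚ) * ((n : ℚ) - 1) / 2 - 4)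
    (hd : (S.map (fun β => headSum (n - 1) β / ((n : ℚ) - 1) * slDim (n - 1) β)).sum
      = (n : ℚ))
    (hdet : (S.map (fun β => slDim (n - 1) β * β (n - 1))).sum = 0) :
    ∃ S', (S' = S ∨ S' = S.map (negLast n)) ∧
      ((n = 4 ∧ S' = {lw [3/2, 1/2, 1/2, 1/2], halfM 4, lw [1, 1, 1, -1]}) ∨
       (n = 4 ∧ S' = {lw [1, 1, 1, 1], lw [1, 1, 1, 1], lw [1, 1, 1, -1],
          halfM 4, halfM 4}) ∨
       (n = 4 ∧ S' = {lw [1, 1], lw [1, 1, 1, -1], lw [1, 1, 1, 1]}) ∨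
       (n = 4 ∧ S' = {lw [1, 1], lw [3/2, 3/2, 3/2, -(1/2)], halfP 4}) ∨
       (n = 4 ∧ S' = {lw [1, 1, 1], lw [1, 1, 1], lw [1, 1, 1], halfM 4, halfP 4}) ∨
       (n = 4 ∧ S' = {lw [1, 1, 1], lw [1, 1, 1, -1], lw [1, 1, 1, 1],
          halfM 4, halfP 4}) ∨
       (n = 4 ∧ S' = {lw [1, 1, 1], lw [1, 1, 1], halfM 4, halfM 4,
          lw [1, 1, 1, 1]}) ∨
       (n = 4 ∧ S' = {lw [2, 2, 2], halfM 4, halfM 4, halfP 4, halfP 4}) ∨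
       (n = 4 ∧ S' = {lw [2, 2, 2, 1], halfM 4, halfM 4, halfM 4, halfP 4}) ∨
       (n = 4 ∧ S' = {halfM 4, halfM 4, halfM 4, halfM 4, lw [2, 2, 2, 2]}) ∨
       (n = 4 ∧ S' = {lw [1, 1, 1], lw [3/2, 3/2, 3/2, 1/2], halfM 4, halfM 4,
          halfP 4}) ∨
       (n = 4 ∧ S' = {lw [1, 1, 1, 1], halfM 4, halfM 4, halfM 4,
          lw [3/2, 3/2, 3/2, 1/2]}) ∨
       (n = 4 ∧ S' = {lw [3/2, 3/2, 3/2, -(1/2)], lw [1, 1, 1, 1], halfM 4,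
          halfM 4, halfP 4}) ∨
       (n = 4 ∧ S' = {lw [1, 1, 1], halfM 4, halfM 4, halfM 4,
          lw [3/2, 3/2, 3/2, 3/2]}) ∨
       (n = 4 ∧ S' = {lw [1, 1, 1, -1], lw [3/2, 3/2, 3/2, 3/2], halfM 4,
          halfM 4, halfP 4}) ∨
       (n = 5 ∧ S' = Multiset.replicate 5 (halfM 5) +
          Multiset.replicate 5 (halfP 5)) ∨
       (n = 5 ∧ S' = {lw [1, 1]} + Multiset.replicate 2 (halfM 5) +
          Multiset.replicate 2 (halfP 5))) := by
  rcases (by omega : n = 4 ∨ 5 ≤ n) with rfl | hn5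
  · norm_num at hr hd hdet
    obtain ⟨T, hT, rfl⟩ := exists_mem_multisetsWithTotals (n := 4) (R := 5) (E := 3) smallWeights
      smallRank smallExcess smallDet [0, 1, 2, 3, 4, 5, 6, 7, 8, 9, 10, 11, 12, 13, 14, 15, 16]
      (by decide) (by decide) slDim_smallWeights
      (by norm_num; exact headSum_smallWeights) det_smallWeights S
      (exists_smallWeights_of_mem S hw hr hd) (by norm_num; exact hr) (by norm_num [hd]) hdet
    have hneg : (T.map smallWeights).map (negLast 4) =
        (T.map smallWeightsNeg).map smallWeights := by
      simp only [Multiset.map_map, Function.comp_def, negLast_smallWeights]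
    rw [hneg]
    rcases multisetsWithTotals_small T hT with rfl | h | h
    · obtain ⟨β, hβ, h⟩ := hnew
      have hβ : β = lw [1, 1] ∨ β = lw [1, 1, 1] := by simpa [smallWeights] using hβ
      rcases hβ with rfl | rfl <;> rcases h with ⟨i, hi, h⟩ | h
      · have h0 := h 0
        have h1 := h 1
        interval_cases i <;> simp [lw] at h0 h1
      · simp [lw] at h
      · have h0 := h 0
        have h1 := h 1
        interval_cases i <;> simp [lw] at h0 h1
      · simp [lw] at h
    all_goals
      have h := List.mem_map_of_mem (f := Multiset.map smallWeights) h
    · refine ⟨_, Or.inl rfl, ?_⟩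
      simpa [smallSolutions, smallWeights] using h
    · refine ⟨_, Or.inr rfl, ?_⟩
      simpa [smallSolutions, smallWeights] using h
  · obtain ⟨rfl, hS⟩ := headSum_eq_two_of_five_le hn5 S hw hr hd
    norm_num at hr hd hdet
    obtain ⟨T, hT, rfl⟩ := exists_mem_multisetsWithTotals (n := 5) (R := 10) (E := 0)
      halfSlopeWeights ![10, 6, 1, 1] (fun _ => 0) ![0, 0, -1, 1] [0, 1, 2, 3]
      (by decide) (by decide)
      (fun i => by
        fin_cases i <;> norm_num [slDim, Finset.prod_range_succ, halfSlopeWeights, lw, halfM,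
          halfP, List.replicate])
      (fun i => by
        fin_cases i <;> norm_num [slDim, headSum_four, Finset.prod_range_succ, halfSlopeWeights,
          lw, halfM, halfP, List.replicate])
      (fun i => by
        fin_cases i <;> norm_num [slDim, Finset.prod_range_succ, halfSlopeWeights, lw, halfM,
          halfP, List.replicate])
      S (fun β hβ => by
        rcases (hw β hβ).1.eq_of_headSum_eq_two (hS β hβ) with h | h | h | h
        exacts [⟨0, h.symm⟩, ⟨1, h.symm⟩, ⟨2, h.symm⟩, ⟨3, h.symm⟩])
      (by norm_num; exact hr) (by norm_num [hd]) hdet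
    rw [multisetsWithTotals_halfSlope] at hT
    simp only [List.mem_cons, List.not_mem_nil, or_false] at hT
    refine ⟨_, Or.inl rfl, ?_⟩
    rcases hT with rfl | rfl | rfl
    · simp [halfSlopeWeights]
    · simp [halfSlopeWeights]
    · obtain ⟨β, hβ, h⟩ := hnew
      obtain rfl : β = lw [2] := by simpa [halfSlopeWeights] using hβ
      rcases h with ⟨i, hi, h⟩ | h
      · have h0 := h 0
        have h2 := h 2
        interval_cases i <;> simp [lw] at h0 h2
      · simp [lw] at h
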